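/- arXiv:2603.08381 — 9 statements merged into one kernel-verified Lean document; each statement's English description precedes it below -/
import Mathlib

section
/- Let m = 2q+1 with q ≥ 1 and let S be a strong starter in ℤ/(3m). Let S_m be the multiset of unordered pairs {x mod m, y mod m} obtained by reducing each pair {x,y} of S modulo m. Then exactly one pair of S_m has two equal entries, and its common value t is nonzero in ℤ/m; moreover, for every d = 1,…,q there are exactly three pairs {a,b} of S_m whose difference satisfies b − a = ±d in ℤ/m. -/
/-- The natural reduction map `ℤ/(3m) → ℤ/m` for `m = 2q+1`. -/
def redMod (q : ℕ) : ZMod (3*(2*q+1)) →+* ZMod (2*q+1) :=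
  ZMod.castHom (dvd_mul_left (2*q+1) 3) (ZMod (2*q+1))

/-- A strong starter in `ℤ/n`, presented as an indexed family of `k` ordered pairs
`(x i, y i)`, `i = 0, …, k-1`:
(i) the `2k` entries are pairwise distinct and comprise `ℤ/n ∖ {0}`;
(ii) the `2k` differences `±(x i − y i)` are pairwise distinct and comprise `ℤ/n ∖ {0}`;
(iii) the `k` sums `x i + y i` are pairwise distinct and nonzero. -/
def IsStrongStarterIdx (n k : ℕ) (x y : ℕ → ZMod n) : Prop :=
  (∀ i j, i < k → j < k → (x i = x j → i = j) ∧ (y i = y j → i = j) ∧ x i ≠ y j) ∧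
  (∀ z : ZMod n, z ≠ 0 ↔ ∃ i, i < k ∧ (x i = z ∨ y i = z)) ∧
  (∀ i j, i < k → j < k → (x i - y i = x j - y j → i = j) ∧ x i - y i ≠ y j - x j) ∧
  (∀ z : ZMod n, z ≠ 0 ↔ ∃ i, i < k ∧ (x i - y i = z ∨ y i - x i = z)) ∧
  (∀ i j, i < k → j < k → x i + y i = x j + y j → i = j) ∧
  (∀ i, i < k → x i + y i ≠ 0)

theorem three_mul_natCast_eq_zero (q : ℕ) :
    (3 : ZMod (3*(2*q+1))) * ((2*q+1 : ℕ) : ZMod (3*(2*q+1))) = 0 := by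
  have h := ZMod.natCast_self (3*(2*q+1))
  rwa [Nat.cast_mul, Nat.cast_ofNat] at h

theorem natCast_ne_zero_of_lt {n a : ℕ} (h0 : 0 < a) (h : a < n) : (a : ZMod n) ≠ 0 := by
  rw [Ne, ZMod.natCast_eq_zero_iff]
  exact Nat.not_dvd_of_pos_of_lt h0 h

theorem redMod_eq_zero_iff (q : ℕ) (w : ZMod (3*(2*q+1))) :
    redMod q w = 0 ↔ w = 0 ∨ w = ((2*q+1 : ℕ) : ZMod (3*(2*q+1))) ∨
      w = -((2*q+1 : ℕ) : ZMod (3*(2*q+1))) := by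
  have hM : redMod q ((2*q+1 : ℕ) : ZMod (3*(2*q+1))) = 0 := by
    rw [map_natCast, ZMod.natCast_self]
  constructor
  · intro h
    have hw : ((w.val : ℕ) : ZMod (3*(2*q+1))) = w := ZMod.natCast_zmod_val w
    rw [← hw, map_natCast, ZMod.natCast_eq_zero_iff] at h
    obtain ⟨c, hc⟩ := h
    have hlt := ZMod.val_lt w
    have hc3 : c < 3 := by
      by_contra! hcon
      nlinarith
    rw [hc, Nat.cast_mul] at hw
    have h3 := three_mul_natCast_eq_zero q
    interval_cases c
    · left
      rw [← hw]
      simp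
    · right; left
      rw [← hw]
      simp
    · right; right
      rw [← hw, Nat.cast_ofNat]
      linear_combination h3
  · rintro (h | h | h) <;> rw [h]
    · exact map_zero _
    · exact hM
    · rw [map_neg, hM, neg_zero]

theorem card_redMod_fiber (q d : ℕ) :
    (Finset.univ.filter fun z : ZMod (3*(2*q+1)) => redMod q z = (d : ZMod (2*q+1))).card = 3 := by
  have hM := natCast_ne_zero_of_lt (n := 3*(2*q+1)) (a := 2*q+1) (by omega) (by omega)
  have h2M := natCast_ne_zero_of_lt (n := 3*(2*q+1)) (a := 2*(2*q+1)) (by omega) (by omega)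
  rw [Nat.cast_mul, Nat.cast_ofNat] at h2M
  rw [Finset.card_eq_three]
  refine ⟨d, d + ((2*q+1 : ℕ) : ZMod (3*(2*q+1))), d - ((2*q+1 : ℕ) : ZMod (3*(2*q+1))),
    ?_, ?_, ?_, ?_⟩
  · exact fun h => hM (by linear_combination -h)
  · exact fun h => hM (by linear_combination h)
  · exact fun h => h2M (by linear_combination h)
  · ext z
    have h := redMod_eq_zero_iff q (z - d)
    rw [map_sub, map_natCast, sub_eq_zero, sub_eq_zero, sub_eq_iff_eq_add', sub_eq_iff_eq_add',
      ← sub_eq_add_neg] at h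
    simpa only [Finset.mem_filter, Finset.mem_univ, true_and, Finset.mem_insert,
      Finset.mem_singleton] using h

/-- in the mod-`m` reduction `S_m` of a strong starter `S` in `ℤ/(3m)`,
exactly one pair has two equal entries and its common value is nonzero; moreover for
each `d = 1,…,q` there are exactly three pairs whose difference is `±d` in `ℤ/m`. -/
theorem stmt1 (q : ℕ) (hq : 1 ≤ q) (x y : ℕ → ZMod (3*(2*q+1)))
    (hS : IsStrongStarterIdx (3*(2*q+1)) (3*q+1) x y) :
    (∃! i, i < 3*q+1 ∧ redMod q (x i) = redMod q (y i)) ∧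
    (∀ i, i < 3*q+1 → redMod q (x i) = redMod q (y i) → redMod q (x i) ≠ 0) ∧
    (∀ d, 1 ≤ d → d ≤ q →
      ((Finset.range (3*q+1)).filter
        (fun i => redMod q (y i) - redMod q (x i) = (d : ZMod (2*q+1)) ∨
                  redMod q (y i) - redMod q (x i) = -(d : ZMod (2*q+1)))).card = 3) := by
  obtain ⟨hdisj, hent, hdiff, hcov, -, hsum⟩ := hS
  have huniq : ∀ i j z, i < 3*q+1 → j < 3*q+1 → (x i - y i = z ∨ y i - x i = z) →
      (x j - y j = z ∨ y j - x j = z) → i = j := by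
    rintro i j z hi hj (h | h) (h' | h')
    · exact (hdiff i j hi hj).1 (h.trans h'.symm)
    · exact absurd (h.trans h'.symm) (hdiff i j hi hj).2
    · exact absurd (h'.trans h.symm) (hdiff j i hj hi).2
    · exact (hdiff i j hi hj).1 (by linear_combination h' - h)
  have hker : ∀ i, i < 3*q+1 → redMod q (x i) = redMod q (y i) →
      x i - y i = ((2*q+1 : ℕ) : ZMod (3*(2*q+1))) ∨
      y i - x i = ((2*q+1 : ℕ) : ZMod (3*(2*q+1))) := by
    intro i hi h
    rw [← sub_eq_zero, ← map_sub, redMod_eq_zero_iff] at h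
    rcases h with h | h | h
    · exact absurd (sub_eq_zero.1 h) (hdisj i i hi hi).2.2
    · exact Or.inl h
    · exact Or.inr (by linear_combination -h)
  refine ⟨?_, ?_, ?_⟩
  · obtain ⟨i, hi, h⟩ := (hcov _).1
      (natCast_ne_zero_of_lt (n := 3*(2*q+1)) (a := 2*q+1) (by omega) (by omega))
    refine ⟨i, ⟨hi, ?_⟩, fun j hj => huniq j i _ hj.1 hi (hker j hj.1 hj.2) h⟩
    have hM : redMod q ((2*q+1 : ℕ) : ZMod (3*(2*q+1))) = 0 := by
      rw [map_natCast, ZMod.natCast_self]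
    rcases h with h | h <;> rw [← h, map_sub, sub_eq_zero] at hM
    · exact hM
    · exact hM.symm
  · intro i hi h h0
    have hx0 : x i ≠ 0 := (hent _).2 ⟨i, hi, Or.inl rfl⟩
    have hy0 : y i ≠ 0 := (hent _).2 ⟨i, hi, Or.inr rfl⟩
    have hne : x i ≠ y i := (hdisj i i hi hi).2.2
    have hs := hsum i hi
    have hx := (redMod_eq_zero_iff q _).1 h0
    have hy := (redMod_eq_zero_iff q _).1 (h ▸ h0)
    rcases hx with hx | hx | hx
    · exact hx0 hx
    · rcases hy with hy | hy | hy
      · exact hy0 hy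
      · exact hne (hx.trans hy.symm)
      · exact hs (by rw [hx, hy, add_neg_cancel])
    · rcases hy with hy | hy | hy
      · exact hy0 hy
      · exact hs (by rw [hx, hy, neg_add_cancel])
      · exact hne (hx.trans hy.symm)
  · intro d hd1 hdq
    have hdd : (d : ZMod (2*q+1)) ≠ -(d : ZMod (2*q+1)) := by
      have h2 := natCast_ne_zero_of_lt (n := 2*q+1) (a := 2*d) (by omega) (by omega)
      rw [Nat.cast_mul, Nat.cast_ofNat] at h2
      exact fun h => h2 (by linear_combination h)
    have hd0 := natCast_ne_zero_of_lt (n := 2*q+1) (a := d) (by omega) (by omega)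
    have hex : ∀ z : ZMod (3*(2*q+1)), ∃ i, redMod q z = d →
        i < 3*q+1 ∧ (x i - y i = z ∨ y i - x i = z) := by
      intro z
      by_cases hz : redMod q z = d
      · obtain ⟨i, hi⟩ := (hcov z).1 (by rintro rfl; exact hd0 (by rw [← hz, map_zero]))
        exact ⟨i, fun _ => hi⟩
      · exact ⟨0, fun h => absurd h hz⟩
    choose f hf using hex
    refine Eq.trans (Eq.symm ?_) (card_redMod_fiber q d)
    refine Finset.card_bij (fun z _ => f z) ?_ ?_ ?_
    · intro z hz
      have hz := (Finset.mem_filter.1 hz).2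
      obtain ⟨hi, h⟩ := hf z hz
      rw [Finset.mem_filter, Finset.mem_range]
      refine ⟨hi, ?_⟩
      rw [← hz, ← map_sub, ← map_neg]
      rcases h with h | h
      · right
        rw [← neg_sub, h]
      · left
        rw [h]
    · intro z hz w hw hzw
      have hz := (Finset.mem_filter.1 hz).2
      have hw := (Finset.mem_filter.1 hw).2
      have h := (hf z hz).2
      have h' := (hf w hw).2
      rw [← hzw] at h'
      have hne : z ≠ -w := by
        rintro rfl
        rw [map_neg, hw] at hz
        exact hdd hz.symm
      rcases h with h | h <;> rcases h' with h' | h'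
      · exact h.symm.trans h'
      · exact absurd (by linear_combination -h - h') hne
      · exact absurd (by linear_combination -h - h') hne
      · exact h.symm.trans h'
    · intro i hi
      rw [Finset.mem_filter, Finset.mem_range] at hi
      obtain ⟨hi, h⟩ := hi
      have key : ∀ z, redMod q z = d → (x i - y i = z ∨ y i - x i = z) →
          ∃ z, ∃ _ : z ∈ Finset.univ.filter
            (fun z : ZMod (3*(2*q+1)) => redMod q z = (d : ZMod (2*q+1))), f z = i :=
        fun z hz h => ⟨z, Finset.mem_filter.2 ⟨Finset.mem_univ z, hz⟩,
          huniq _ _ z (hf z hz).1 hi (hf z hz).2 h⟩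
      rcases h with h | h
      · exact key (y i - x i) (by rw [map_sub, h]) (Or.inr rfl)
      · exact key (x i - y i) (by rw [map_sub]; linear_combination -h) (Or.inl rfl)
end

section
/- Let m = 2q+1 with q ≥ 1 and let S be a strong starter in ℤ/(3m). Then no two distinct pairs of S reduce modulo m to the same unordered pair: if {x,y} and {x′,y′} are pairs of S with {x mod m, y mod m} = {x′ mod m, y′ mod m} as unordered pairs in ℤ/m, then {x,y} = {x′,y′}. Equivalently, the 3q+1 reduced pairs of S_m are pairwise distinct. -/
theorem redMod_eq_zero_cases {q : ℕ} {z : ZMod (3*(2*q+1))} (hz : redMod q z = 0) :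
    z = 0 ∨ z = (2*q+1 : ℕ) ∨ z = -(2*q+1 : ℕ) := by
  have h3 : (3 : ZMod (3*(2*q+1))) * (2*q+1 : ℕ) = 0 := by
    exact_mod_cast ZMod.natCast_self (3*(2*q+1))
  have hval : redMod q z = (z.val : ZMod (2*q+1)) := by
    conv_lhs => rw [← ZMod.natCast_zmod_val z]
    exact map_natCast _ _
  obtain ⟨c, hc⟩ := (ZMod.natCast_eq_zero_iff _ _).1 (hval.symm.trans hz)
  have hlt := ZMod.val_lt z
  rw [hc, mul_comm 3] at hlt
  have hc3 : c < 3 := Nat.lt_of_mul_lt_mul_left hlt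
  have hzc : z = (2*q+1 : ℕ) * (c : ZMod (3*(2*q+1))) := by
    rw [← ZMod.natCast_zmod_val z, hc, Nat.cast_mul]
  interval_cases c
  · exact Or.inl (by simpa using hzc)
  · exact Or.inr (Or.inl (by simpa using hzc))
  · exact Or.inr (Or.inr (by rw [hzc]; push_cast at h3 ⊢; linear_combination h3))

/-- The two nonzero elements of the kernel of the reduction are opposite to each other. -/
theorem add_eq_zero_of_redMod_eq_zero {q : ℕ} {a b : ZMod (3*(2*q+1))}
    (ha : redMod q a = 0) (hb : redMod q b = 0) (ha0 : a ≠ 0) (hb0 : b ≠ 0) (hab : a ≠ b) :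
    a + b = 0 := by
  rcases redMod_eq_zero_cases ha with h | h | h <;>
    rcases redMod_eq_zero_cases hb with h' | h' | h' <;> simp_all

/-- no two distinct pairs of a strong starter `S` in `ℤ/(3m)` reduce
modulo `m` to the same unordered pair. -/
theorem stmt3 (q : ℕ) (hq : 1 ≤ q) (x y : ℕ → ZMod (3*(2*q+1)))
    (hS : IsStrongStarterIdx (3*(2*q+1)) (3*q+1) x y) :
    ∀ i j, i < 3*q+1 → j < 3*q+1 →
      ((redMod q (x i) = redMod q (x j) ∧ redMod q (y i) = redMod q (y j)) ∨
       (redMod q (x i) = redMod q (y j) ∧ redMod q (y i) = redMod q (x j))) →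
      i = j := by
  obtain ⟨hentry, -, hdiff, -, hsum, -⟩ := hS
  intro i j hi hj h
  by_contra hij
  rcases h with ⟨hx, hy⟩ | ⟨hx, hy⟩
  · have key := add_eq_zero_of_redMod_eq_zero (a := x i - x j) (b := y i - y j)
      (by rw [map_sub, hx, sub_self]) (by rw [map_sub, hy, sub_self])
      (fun e => hij ((hentry i j hi hj).1 (sub_eq_zero.1 e)))
      (fun e => hij ((hentry i j hi hj).2.1 (sub_eq_zero.1 e)))
      (fun e => hij ((hdiff i j hi hj).1 (by linear_combination e)))
    exact hij (hsum i j hi hj (by linear_combination key))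
  · have key := add_eq_zero_of_redMod_eq_zero (a := x i - y j) (b := y i - x j)
      (by rw [map_sub, hx, sub_self]) (by rw [map_sub, hy, sub_self])
      (fun e => (hentry i j hi hj).2.2 (sub_eq_zero.1 e))
      (fun e => (hentry j i hj hi).2.2 (sub_eq_zero.1 e).symm)
      (fun e => (hdiff i j hi hj).2 (by linear_combination e))
    exact hij (hsum i j hi hj (by linear_combination key))
end

section
/- Let Σ = [(u_0,v_0),…,(u_{3q},v_{3q})] be a triplication table of order m = 2q+1 with key t = u_0 = v_0. For j = 0,1,2 let T_j be the list of the q pairs occupying column j of the regular part of Σ, i.e. T_0 = [(u_{3d−2}, v_{3d−2})]_{d=1}^{q}, T_1 = [(u_{3d−1}, v_{3d−1})]_{d=1}^{q}, T_2 = [(u_{3d}, v_{3d})]_{d=1}^{q}. Then each T_j is a pseudostarter in ℤ/m, and the triple (T_0, T_1, T_2) is balanced: in the multiset union of all components of T_0, T_1, T_2, the element 0 occurs exactly twice, the key t occurs exactly once, and every other nonzero element of ℤ/m occurs exactly three times. -/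
/-- A triplication table of order `m = 2q+1`, presented as an indexed family of `3q+1`
ordered pairs `(u i, v i)`, `i = 0,…,3q`:
(i) among the `6q+2` components, each nonzero element of `ℤ/m` occurs exactly three
times and `0` occurs exactly twice;
(ii) `u 0 = v 0 ≠ 0`, and for each `d = 1,…,q` there is a sign `ε ∈ {1,-1}` with
`v i − u i = ε·d` for `i ∈ {3d−2, 3d−1, 3d}`;
(iii) at most three pairs have any given nonzero sum, at most two pairs have sum `0`;
(iv) the `3q+1` ordered pairs are pairwise distinct. -/
def IsTriplicationTable (q : ℕ) (u v : ℕ → ZMod (2*q+1)) : Prop :=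
  (∀ c : ZMod (2*q+1),
    (((Finset.range (3*q+1)) ×ˢ (Finset.univ : Finset Bool)).filter
      (fun p => (if p.2 then v p.1 else u p.1) = c)).card = if c = 0 then 2 else 3) ∧
  (u 0 = v 0 ∧ u 0 ≠ 0) ∧
  (∀ d, 1 ≤ d → d ≤ q → ∃ ε : ℤ, (ε = 1 ∨ ε = -1) ∧
    v (3*d-2) - u (3*d-2) = (ε : ZMod (2*q+1)) * (d : ZMod (2*q+1)) ∧
    v (3*d-1) - u (3*d-1) = (ε : ZMod (2*q+1)) * (d : ZMod (2*q+1)) ∧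
    v (3*d) - u (3*d) = (ε : ZMod (2*q+1)) * (d : ZMod (2*q+1))) ∧
  (∀ s : ZMod (2*q+1), s ≠ 0 →
    ((Finset.range (3*q+1)).filter (fun i => u i + v i = s)).card ≤ 3) ∧
  (((Finset.range (3*q+1)).filter (fun i => u i + v i = 0)).card ≤ 2) ∧
  (∀ i j, i < 3*q+1 → j < 3*q+1 → u i = u j → v i = v j → i = j)

/-- A pseudostarter in `ℤ/m`, `m = 2q+1`: a list of `q` pairs `(a d, b d)`,
`d = 1,…,q`, such that the `2q` differences `±(b d − a d)` comprise `ℤ/m ∖ {0}`. -/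
def IsPseudostarter (q : ℕ) (a b : ℕ → ZMod (2*q+1)) : Prop :=
  ∀ z : ZMod (2*q+1), z ≠ 0 ↔ ∃ d, 1 ≤ d ∧ d ≤ q ∧ (b d - a d = z ∨ a d - b d = z)

/-- The nonzero elements of `ℤ/(2q+1)` are exactly `±1, …, ±q`. -/
theorem ZMod.ne_zero_iff_exists_eq_or_neg_eq (q : ℕ) (z : ZMod (2*q+1)) :
    z ≠ 0 ↔ ∃ d : ℕ, 1 ≤ d ∧ d ≤ q ∧ ((d : ZMod (2*q+1)) = z ∨ -(d : ZMod (2*q+1)) = z) := by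
  constructor
  · intro hz
    refine ⟨z.valMinAbs.natAbs, ?_, ?_, ?_⟩
    · exact Nat.one_le_iff_ne_zero.2 (by simpa using hz)
    · have h := ZMod.natAbs_valMinAbs_le z
      omega
    · have h : ((z.valMinAbs : ℤ) : ZMod (2*q+1)) = z := ZMod.coe_valMinAbs z
      rcases Int.natAbs_eq z.valMinAbs with h' | h' <;> rw [h'] at h
      · exact Or.inl (by rwa [Int.cast_natCast] at h)
      · exact Or.inr (by rwa [Int.cast_neg, Int.cast_natCast] at h)
  · rintro ⟨d, hd, hdq, h⟩ rfl
    have hd0 : (d : ZMod (2*q+1)) = 0 := by simpa using h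
    have := Nat.le_of_dvd hd ((ZMod.natCast_eq_zero_iff d (2*q+1)).1 hd0)
    omega

/-- A family of pairs whose `d`-th difference is `±d` is a pseudostarter. -/
theorem isPseudostarter_of_sub_eq {q : ℕ} {a b : ℕ → ZMod (2*q+1)}
    (h : ∀ d, 1 ≤ d → d ≤ q → ∃ ε : ℤ, (ε = 1 ∨ ε = -1) ∧
      b d - a d = (ε : ZMod (2*q+1)) * (d : ZMod (2*q+1))) :
    IsPseudostarter q a b := by
  intro z
  rw [ZMod.ne_zero_iff_exists_eq_or_neg_eq]
  refine exists_congr fun d => and_congr_right fun hd => and_congr_right fun hdq => ?_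
  obtain ⟨ε, hε, hdiff⟩ := h d hd hdq
  rw [← neg_sub (b d) (a d), hdiff]
  rcases hε with rfl | rfl
  · simp
  · simp [or_comm]

/-- Splitting a sum over `0, …, 3q` into its first term and `q` consecutive blocks of three. -/
theorem Finset.sum_range_three_mul_add_one {M : Type*} [AddCommMonoid M] (f : ℕ → M) (q : ℕ) :
    ∑ i ∈ Finset.range (3*q+1), f i =
      f 0 + ∑ d ∈ Finset.Icc 1 q, ∑ k : Fin 3, f (3*d-2+k) := by
  induction q with
  | zero => simp
  | succ n ih =>
    rw [show 3*(n+1)+1 = 3*n+1+1+1+1 by ring, Finset.sum_range_succ, Finset.sum_range_succ,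
      Finset.sum_range_succ, ih, Finset.sum_Icc_succ_top (by omega), Fin.sum_univ_three,
      show 3*(n+1)-2 = 3*n+1 by omega]
    simp [add_assoc]

/-- the three columns of the regular part of a triplication table form a
balanced triple of pseudostarters: each column is a pseudostarter, and in the multiset
union of all their components `0` occurs exactly twice, the key `t = u 0` exactly once,
and every other nonzero element of `ℤ/m` exactly three times. -/
theorem stmt4 (q : ℕ) (hq : 1 ≤ q) (u v : ℕ → ZMod (2*q+1))
    (htt : IsTriplicationTable q u v) :
    (∀ j, j < 3 →
      IsPseudostarter q (fun d => u (3*d-2+j)) (fun d => v (3*d-2+j))) ∧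
    (∀ c : ZMod (2*q+1),
      (((Finset.Icc 1 q) ×ˢ (Finset.univ : Finset (Fin 3 × Bool))).filter
        (fun p => (if p.2.2 then v (3*p.1-2+(p.2.1 : ℕ)) else u (3*p.1-2+(p.2.1 : ℕ))) = c)).card
        = if c = 0 then 2 else if c = u 0 then 1 else 3) := by
  obtain ⟨hcount, ⟨huv, hu⟩, hdiff, -⟩ := htt
  refine ⟨fun j hj => isPseudostarter_of_sub_eq fun d hd hdq => ?_, fun c => ?_⟩
  · obtain ⟨ε, hε, h0, h1, h2⟩ := hdiff d hd hdq
    refine ⟨ε, hε, ?_⟩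
    interval_cases j
    · exact h0
    · rwa [show 3*d-2+1 = 3*d-1 by omega]
    · rwa [show 3*d-2+2 = 3*d by omega]
  · have h := hcount c
    rw [Finset.card_filter, Finset.sum_product, Finset.sum_range_three_mul_add_one] at h
    rw [Finset.card_filter, Finset.sum_product]
    simp only [Fintype.sum_prod_type]
    simp only [Fintype.sum_bool, ← huv, Bool.false_eq_true, if_true, if_false] at h ⊢
    by_cases hc : c = 0
    · subst hc
      simpa [hu] using h
    · by_cases hcu : c = u 0
      · subst hcu
        simp only [hu, if_true, if_false] at h ⊢
        omega
      · simpa [hc, hcu, Ne.symm hcu] using h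
end

section
/- Let m = 2q+1 ≥ 3 be odd, let r ≥ 3, and let f : ℤ/(3m) → ℤ/r satisfy f(0) = 0 and be such that the map Φ : ℤ/(3m) → ℤ/m × ℤ/r, Φ(x) = (x mod m, f(x)), is injective. Let Σ = [(u_i,v_i)]_{i=0}^{3q} be a triplication table of order m, and let x_i, y_i ∈ ℤ/(3m) (i = 0,…,3q) satisfy x_i ≡ u_i (mod m) and y_i ≡ v_i (mod m) and the Sudoku constraints (Row), (Sum), (Color) with respect to f. Then the 3q+1 unordered pairs {x_i, y_i} constitute a strong starter in ℤ/(3m). -/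
/-- The Sudoku constraints (Row), (Sum), (Color) for a discriminating function
`f : ℤ/(3m) → ℤ/r` (`m = 2q+1`), a triplication table `(u, v)` of order `m`, and
elements `x i, y i ∈ ℤ/(3m)` aligned with the table:
(Row) `f (x 0 − y 0) ≠ 0` and in each regular row the three values `f (x i − y i)`
are pairwise distinct;
(Sum) pairs of the table with equal sums in `ℤ/m` have distinct values `f (x i + y i)`,
and pairs with sum `0` in `ℤ/m` have `f (x i + y i) ≠ 0`;
(Color) component positions of the table carrying the same value of `ℤ/m` carry
distinct discriminating values (`f (x i)` for a `u`-component, `f (y i)` for a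
`v`-component), and positions carrying `0` carry nonzero discriminating values. -/
def SudokuConstraints (q r : ℕ) (u v : ℕ → ZMod (2*q+1))
    (f : ZMod (3*(2*q+1)) → ZMod r) (x y : ℕ → ZMod (3*(2*q+1))) : Prop :=
  (f (x 0 - y 0) ≠ 0) ∧
  (∀ d, 1 ≤ d → d ≤ q →
    f (x (3*d-2) - y (3*d-2)) ≠ f (x (3*d-1) - y (3*d-1)) ∧
    f (x (3*d-2) - y (3*d-2)) ≠ f (x (3*d) - y (3*d)) ∧
    f (x (3*d-1) - y (3*d-1)) ≠ f (x (3*d) - y (3*d))) ∧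
  (∀ i j, i < 3*q+1 → j < 3*q+1 → i ≠ j → u i + v i = u j + v j →
    f (x i + y i) ≠ f (x j + y j)) ∧
  (∀ i, i < 3*q+1 → u i + v i = 0 → f (x i + y i) ≠ 0) ∧
  (∀ i j, i < 3*q+1 → j < 3*q+1 → ∀ bi bj : Bool, (i, bi) ≠ (j, bj) →
    (if bi then v i else u i) = (if bj then v j else u j) →
    (if bi then f (y i) else f (x i)) ≠ (if bj then f (y j) else f (x j))) ∧
  (∀ i, i < 3*q+1 → ∀ b : Bool, (if b then v i else u i) = 0 →
    (if b then f (y i) else f (x i)) ≠ 0)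

theorem ZMod.intCast_inj_of_abs_le {q : ℕ} {a b : ℤ} (ha : |a| ≤ q) (hb : |b| ≤ q)
    (h : (a : ZMod (2*q+1)) = b) : a = b := by
  have h1 := (ZMod.intCast_eq_intCast_iff_dvd_sub a b (2*q+1)).1 h
  rw [abs_le] at ha hb
  have h2 := Int.eq_zero_of_abs_lt_dvd h1 (by rw [abs_lt]; push_cast; omega)
  omega

/-- `2k` distinct nonzero elements of a ring of `2k+1` elements exhaust the nonzero elements. -/
theorem ZMod.ne_zero_iff_exists_of_distinct {n k : ℕ} (hn : n = 2*k+1) (a b : ℕ → ZMod n)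
    (hab : ∀ i j, i < k → j < k → (a i = a j → i = j) ∧ (b i = b j → i = j) ∧ a i ≠ b j)
    (h0 : ∀ i, i < k → a i ≠ 0 ∧ b i ≠ 0) (z : ZMod n) :
    z ≠ 0 ↔ ∃ i, i < k ∧ (a i = z ∨ b i = z) := by
  classical
  have : NeZero n := ⟨by omega⟩
  set A := (Finset.range k).image a
  set B := (Finset.range k).image b
  have hA : A.card = k := by
    rw [Finset.card_image_of_injOn, Finset.card_range]
    intro i hi j hj h
    exact (hab i j (by simpa using hi) (by simpa using hj)).1 h
  have hB : B.card = k := by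
    rw [Finset.card_image_of_injOn, Finset.card_range]
    intro i hi j hj h
    exact (hab i j (by simpa using hi) (by simpa using hj)).2.1 h
  have hd : Disjoint A B := by
    rw [Finset.disjoint_left]
    intro w hwA hwB
    obtain ⟨i, hi, rfl⟩ := Finset.mem_image.1 hwA
    obtain ⟨j, hj, h⟩ := Finset.mem_image.1 hwB
    exact (hab i j (by simpa using hi) (by simpa using hj)).2.2 h.symm
  have hsub : A ∪ B ⊆ Finset.univ.erase 0 := by
    intro w hw
    simp only [A, B, Finset.mem_union, Finset.mem_image, Finset.mem_range] at hw
    rw [Finset.mem_erase]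
    rcases hw with ⟨i, hi, rfl⟩ | ⟨i, hi, rfl⟩
    · exact ⟨(h0 i hi).1, Finset.mem_univ _⟩
    · exact ⟨(h0 i hi).2, Finset.mem_univ _⟩
  have heq : A ∪ B = Finset.univ.erase 0 := by
    refine Finset.eq_of_subset_of_card_le hsub ?_
    rw [Finset.card_union_of_disjoint hd, hA, hB, Finset.card_erase_of_mem (Finset.mem_univ _),
      Finset.card_univ, ZMod.card]
    omega
  have hz : z ∈ A ∪ B ↔ z ∈ Finset.univ.erase 0 := by rw [heq]
  simp only [A, B, Finset.mem_union, Finset.mem_image, Finset.mem_range, Finset.mem_erase,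
    Finset.mem_univ, and_true] at hz
  rw [← hz]
  constructor
  · rintro (⟨i, hi, h⟩ | ⟨i, hi, h⟩)
    exacts [⟨i, hi, Or.inl h⟩, ⟨i, hi, Or.inr h⟩]
  · rintro ⟨i, hi, h | h⟩
    exacts [Or.inl ⟨i, hi, h⟩, Or.inr ⟨i, hi, h⟩]

/-- The difference along row `d = ⌈i/3⌉` of a triplication table is `σ d`, for an integer `σ d`
with `|σ d| = d`. -/
theorem IsTriplicationTable.exists_row_diff {q : ℕ} {u v : ℕ → ZMod (2*q+1)}
    (h : IsTriplicationTable q u v) :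
    ∃ σ : ℕ → ℤ, (∀ d, |σ d| = d) ∧
      ∀ i, i < 3*q+1 → v i - u i = (σ ((i+2)/3) : ZMod (2*q+1)) := by
  obtain ⟨-, ⟨h0, -⟩, hrow, -⟩ := h
  have key : ∀ d : ℕ, ∃ s : ℤ, |s| = d ∧
      ∀ i, i < 3*q+1 → (i+2)/3 = d → v i - u i = (s : ZMod (2*q+1)) := by
    intro d
    by_cases hd : 1 ≤ d ∧ d ≤ q
    · obtain ⟨ε, hε, h1, h2, h3⟩ := hrow d hd.1 hd.2
      refine ⟨ε * d, ?_, ?_⟩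
      · rcases hε with rfl | rfl <;> simp
      · intro i hi hid
        push_cast
        obtain rfl | rfl | rfl : i = 3*d-2 ∨ i = 3*d-1 ∨ i = 3*d := by omega
        exacts [h1, h2, h3]
    · refine ⟨d, by simp, ?_⟩
      intro i hi hid
      obtain rfl : i = 0 := by omega
      obtain rfl : d = 0 := by omega
      simp [h0]
  choose σ hσ hσ' using key
  exact ⟨σ, hσ, fun i hi => hσ' _ i hi rfl⟩

/-- Theorem `thm:main`: given a triplication table of order `m = 2q+1`,
a discriminating function `f : ℤ/(3m) → ℤ/r` (`r ≥ 3`, `f 0 = 0`, `Φ` injective), and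
elements `x i, y i` reducing to the table modulo `m` and satisfying the Sudoku
constraints, the pairs `{x i, y i}` constitute a strong starter in `ℤ/(3m)`. -/
theorem stmt6 (q : ℕ) (hq : 1 ≤ q) (r : ℕ) (hr : 3 ≤ r)
    (f : ZMod (3*(2*q+1)) → ZMod r) (hf0 : f 0 = 0)
    (hΦ : Function.Injective fun z : ZMod (3*(2*q+1)) => (redMod q z, f z))
    (u v : ℕ → ZMod (2*q+1)) (htt : IsTriplicationTable q u v)
    (x y : ℕ → ZMod (3*(2*q+1)))
    (hred : ∀ i, i < 3*q+1 → redMod q (x i) = u i ∧ redMod q (y i) = v i)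
    (hsud : SudokuConstraints q r u v f x y) :
    IsStrongStarterIdx (3*(2*q+1)) (3*q+1) x y := by
  obtain ⟨σ, hσ, hdiff⟩ := htt.exists_row_diff
  obtain ⟨hrow0, hrow, hsum, hsum0, hcol, hcol0⟩ := hsud
  have hσq : ∀ i, i < 3*q+1 → |σ ((i+2)/3)| ≤ q := by
    intro i hi
    rw [hσ]
    exact_mod_cast (by omega : (i+2)/3 ≤ q)
  have hdiff' : ∀ i, i < 3*q+1 → redMod q (y i - x i) = (σ ((i+2)/3) : ZMod (2*q+1)) := by
    intro i hi
    rw [map_sub, (hred i hi).1, (hred i hi).2, hdiff i hi]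
  have hdist : ∀ i j, i < 3*q+1 → j < 3*q+1 →
      (x i = x j → i = j) ∧ (y i = y j → i = j) ∧ x i ≠ y j := by
    intro i j hi hj
    refine ⟨fun h => ?_, fun h => ?_, fun h => ?_⟩
    · by_contra hij
      refine hcol i j hi hj false false (by simpa using hij) ?_ (by simp [h])
      simp [← (hred i hi).1, ← (hred j hj).1, h]
    · by_contra hij
      refine hcol i j hi hj true true (by simpa using hij) ?_ (by simp [h])
      simp [← (hred i hi).2, ← (hred j hj).2, h]
    · refine hcol i j hi hj false true (by simp) ?_ (by simp [h])
      simp [← (hred i hi).1, ← (hred j hj).2, h]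
  have hne : ∀ i, i < 3*q+1 → x i ≠ 0 ∧ y i ≠ 0 := by
    intro i hi
    refine ⟨fun h => ?_, fun h => ?_⟩
    · exact hcol0 i hi false (by simp [← (hred i hi).1, h]) (by simp [h, hf0])
    · exact hcol0 i hi true (by simp [← (hred i hi).2, h]) (by simp [h, hf0])
  have hdne : ∀ i, i < 3*q+1 → x i - y i ≠ 0 ∧ y i - x i ≠ 0 := by
    intro i hi
    have hxy := (hdist i i hi hi).2.2
    exact ⟨sub_ne_zero.2 hxy, sub_ne_zero.2 hxy.symm⟩
  have hdinj : ∀ i j, i < 3*q+1 → j < 3*q+1 → x i - y i = x j - y j → i = j := by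
    intro i j hi hj h
    have h' : y i - x i = y j - x j := by rw [← neg_sub, h, neg_sub]
    have hs := ZMod.intCast_inj_of_abs_le (hσq i hi) (hσq j hj)
      (by rw [← hdiff' i hi, ← hdiff' j hj, h'])
    have hd : (i+2)/3 = (j+2)/3 := by
      have := congrArg abs hs
      rw [hσ, hσ] at this
      exact_mod_cast this
    by_contra hij
    obtain ⟨d, hdi⟩ : ∃ d, (i+2)/3 = d := ⟨_, rfl⟩
    obtain ⟨h1, h2, h3⟩ := hrow d (by omega) (by omega)
    have hf := congrArg f h
    obtain rfl | rfl | rfl : i = 3*d-2 ∨ i = 3*d-1 ∨ i = 3*d := by omega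
    all_goals obtain rfl | rfl | rfl : j = 3*d-2 ∨ j = 3*d-1 ∨ j = 3*d := by omega
    all_goals first
      | exact hij rfl
      | exact h1 hf
      | exact h2 hf
      | exact h3 hf
      | exact h1 hf.symm
      | exact h2 hf.symm
      | exact h3 hf.symm
  have hdneg : ∀ i j, i < 3*q+1 → j < 3*q+1 → x i - y i ≠ y j - x j := by
    intro i j hi hj h
    have hs := ZMod.intCast_inj_of_abs_le (a := -σ ((i+2)/3)) (by rw [abs_neg]; exact hσq i hi)
      (hσq j hj) (by rw [Int.cast_neg, ← hdiff' i hi, ← hdiff' j hj, ← h, ← map_neg, neg_sub])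
    have hd : (i+2)/3 = (j+2)/3 := by
      have := congrArg abs hs
      rw [abs_neg, hσ, hσ] at this
      exact_mod_cast this
    rw [← hd] at hs
    have hz : ((i+2)/3 : ℕ) = 0 := by
      have h1 := hσ ((i+2)/3)
      rw [show σ ((i+2)/3) = 0 by omega, abs_zero] at h1
      exact_mod_cast h1.symm
    obtain rfl : i = 0 := by omega
    obtain rfl : j = 0 := by omega
    have hodd : Odd (3*(2*q+1)) := ⟨3*q+1, by ring⟩
    have : Fact (Odd (3*(2*q+1))) := ⟨hodd⟩
    have hself : -(x 0 - y 0) = x 0 - y 0 := by rw [neg_sub, h]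
    exact (hdne 0 hi).1 ((ZMod.neg_eq_self_iff _).1 hself |>.resolve_right fun h2 => by
      rw [← h2] at hodd
      exact (Nat.not_odd_iff_even.2 (even_two_mul _)) hodd)
  refine ⟨hdist, ZMod.ne_zero_iff_exists_of_distinct (by ring) x y hdist hne,
    fun i j hi hj => ⟨hdinj i j hi hj, hdneg i j hi hj⟩,
    ZMod.ne_zero_iff_exists_of_distinct (by ring) (fun i => x i - y i) (fun i => y i - x i)
      (fun i j hi hj => ⟨hdinj i j hi hj, fun h => hdinj i j hi hj ?_, hdneg i j hi hj⟩) hdne,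
    fun i j hi hj h => ?_, fun i hi h => ?_⟩
  · rw [← neg_sub, ← neg_sub (y j)]
    exact congrArg Neg.neg h
  · by_contra hij
    refine hsum i j hi hj hij ?_ (by rw [h])
    rw [← (hred i hi).1, ← (hred i hi).2, ← (hred j hj).1, ← (hred j hj).2, ← map_add, h, map_add]
  · refine hsum0 i hi ?_ (by rw [h, hf0])
    rw [← (hred i hi).1, ← (hred i hi).2, ← map_add, h, map_zero]
end

section
/- Let m = 2q+1 ≥ 3 be odd and let Σ = [(u_i,v_i)]_{i=0}^{3q} be a triplication table of order m. Let r_A, r_B ≥ 3 and let f_A : ℤ/(3m) → ℤ/r_A and f_B : ℤ/(3m) → ℤ/r_B each satisfy f(0) = 0 and have injective associated map Φ(x) = (x mod m, f(x)). Then a pairing [(x_i, y_i)]_{i=0}^{3q} of elements of ℤ/(3m) is congruous with Σ in the scenario f_A if and only if it is congruous with Σ in the scenario f_B. In particular, the set of strong starters obtainable from Σ by the triplication method is independent of the discrimination scenario used. -/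
/-- A pairing `(x i, y i)` in `ℤ/(3m)` is congruous with the triplication table
`(u, v)` in the scenario given by `f` if it reduces to the table modulo `m` and the
Sudoku constraints hold. -/
def Congruous (q r : ℕ) (u v : ℕ → ZMod (2*q+1))
    (f : ZMod (3*(2*q+1)) → ZMod r) (x y : ℕ → ZMod (3*(2*q+1))) : Prop :=
  (∀ i, i < 3*q+1 → redMod q (x i) = u i ∧ redMod q (y i) = v i) ∧
  SudokuConstraints q r u v f x y

/-- Congruity passes from any scenario `f` with `f 0 = 0` to any discriminating scenario `g`:
the Sudoku constraints only compare elements with the same residue modulo `m`, where `g`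
separates as much as possible. -/
theorem Congruous.change_scenario {q r s : ℕ} {u v : ℕ → ZMod (2*q+1)}
    {f : ZMod (3*(2*q+1)) → ZMod r} {g : ZMod (3*(2*q+1)) → ZMod s}
    {x y : ℕ → ZMod (3*(2*q+1))} (h : Congruous q r u v f x y) (hf0 : f 0 = 0) (hg0 : g 0 = 0)
    (hg : Function.Injective fun z : ZMod (3*(2*q+1)) => (redMod q z, g z))
    (htt : IsTriplicationTable q u v) : Congruous q s u v g x y := by
  obtain ⟨hred, hrow₀, hrow, hsum, hsum₀, hcol, hcol₀⟩ := h
  obtain ⟨-, ⟨huv₀, -⟩, hdiff, -⟩ := htt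
  have separates {z w : ZMod (3*(2*q+1))} (hzw : redMod q z = redMod q w)
      (hne : f z ≠ f w) : g z ≠ g w :=
    fun he => hne (congrArg f (hg (Prod.ext hzw he)))
  have separates_zero {z : ZMod (3*(2*q+1))} (hz : redMod q z = 0)
      (hne : f z ≠ 0) : g z ≠ 0 := by
    rw [← hg0]
    exact separates (by rw [hz, map_zero]) (by rwa [hf0])
  have red_sub {i : ℕ} (hi : i < 3*q+1) : redMod q (x i - y i) = -(v i - u i) := by
    rw [map_sub, (hred i hi).1, (hred i hi).2, neg_sub]
  have red_add {i : ℕ} (hi : i < 3*q+1) : redMod q (x i + y i) = u i + v i := by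
    rw [map_add, (hred i hi).1, (hred i hi).2]
  have red_ite {i : ℕ} (hi : i < 3*q+1) (b : Bool) :
      redMod q (if b then y i else x i) = if b then v i else u i := by
    cases b
    · exact (hred i hi).1
    · exact (hred i hi).2
  refine ⟨hred, ?_, ?_, ?_, ?_, ?_, ?_⟩
  · exact separates_zero (by rw [red_sub (by omega), huv₀, sub_self, neg_zero]) hrow₀
  · intro d hd hdq
    obtain ⟨ε, -, h₂, h₁, h₀⟩ := hdiff d hd hdq
    obtain ⟨n₁, n₂, n₃⟩ := hrow d hd hdq
    have r₂ := red_sub (i := 3*d-2) (by omega)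
    have r₁ := red_sub (i := 3*d-1) (by omega)
    have r₀ := red_sub (i := 3*d) (by omega)
    rw [h₂] at r₂
    rw [h₁] at r₁
    rw [h₀] at r₀
    exact ⟨separates (r₂.trans r₁.symm) n₁, separates (r₂.trans r₀.symm) n₂,
      separates (r₁.trans r₀.symm) n₃⟩
  · intro i j hi hj hij he
    exact separates (by rw [red_add hi, red_add hj, he]) (hsum i j hi hj hij he)
  · intro i hi he
    exact separates_zero (by rw [red_add hi, he]) (hsum₀ i hi he)
  · intro i j hi hj bi bj hne he
    have hf := hcol i j hi hj bi bj hne he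
    rw [← apply_ite f, ← apply_ite f] at hf
    rw [← apply_ite g, ← apply_ite g]
    exact separates (by rw [red_ite hi, red_ite hj, he]) hf
  · intro i hi b he
    have hf := hcol₀ i hi b he
    rw [← apply_ite f] at hf
    rw [← apply_ite g]
    exact separates_zero (by rw [red_ite hi, he]) hf

/-- Theorem `thm:scenario-independence`: for a triplication table of
order `m = 2q+1` and two valid discrimination scenarios `f_A`, `f_B` (each with
`f 0 = 0` and injective `Φ`), a pairing is congruous with the table in scenario `f_A`
iff it is congruous in scenario `f_B`; hence the set of strong starters obtainable by
triplication does not depend on the scenario. -/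
theorem stmt8 (q : ℕ) (hq : 1 ≤ q)
    (rA rB : ℕ) (hrA : 3 ≤ rA) (hrB : 3 ≤ rB)
    (fA : ZMod (3*(2*q+1)) → ZMod rA) (hfA0 : fA 0 = 0)
    (hΦA : Function.Injective fun z : ZMod (3*(2*q+1)) => (redMod q z, fA z))
    (fB : ZMod (3*(2*q+1)) → ZMod rB) (hfB0 : fB 0 = 0)
    (hΦB : Function.Injective fun z : ZMod (3*(2*q+1)) => (redMod q z, fB z))
    (u v : ℕ → ZMod (2*q+1)) (htt : IsTriplicationTable q u v)
    (x y : ℕ → ZMod (3*(2*q+1))) :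
    Congruous q rA u v fA x y ↔ Congruous q rB u v fB x y := by
  exact ⟨fun h => h.change_scenario hfA0 hfB0 hΦB htt, fun h => h.change_scenario hfB0 hfA0 hΦA htt⟩
end

section
/- Let p be odd with gcd(p,3) = 1, let ν ≥ 1, and let m = 3^ν·p = 2q+1. Let Σ = [(u_i,v_i)]_{i=0}^{3q} be a triplication table of order m, with components represented by integers u_i, v_i ∈ {0,…,m−1}. Let U_i, V_i ∈ {0,…,3^{ν+1}−1} (i = 0,…,3q) satisfy the compatibility conditions U_i ≡ u_i (mod 3^ν) and V_i ≡ v_i (mod 3^ν) together with: (Row) (U_0 − V_0) mod 3^{ν+1} ≠ 0, and for each d = 1,…,q the three values (U_i − V_i) mod 3^{ν+1}, i ∈ {3d−2,3d−1,3d}, are pairwise distinct; (Sum) whenever i ≠ j and u_i+v_i ≡ u_j+v_j (mod m) then U_i+V_i ≢ U_j+V_j (mod 3^{ν+1}), and whenever u_i+v_i ≡ 0 (mod m) then U_i+V_i ≢ 0 (mod 3^{ν+1}); (Color) whenever two distinct component positions of Σ carry the same integer value c, the corresponding values among the U_i (for a u-component) and V_i (for a v-component) are distinct, and when c = 0 they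 are moreover nonzero. For each i let x_i be the unique integer in {0,…,3m−1} with x_i ≡ u_i (mod m) and x_i ≡ U_i (mod 3^{ν+1}) (such x_i exists and is unique because u_i ≡ U_i (mod 3^ν)), and define y_i similarly from v_i, V_i. Then the 3q+1 unordered pairs {x_i, y_i} (taken modulo 3m) constitute a strong starter in ℤ/(3m). -/
/-- Two injective families of `k` nonzero residues modulo `2k+1` with disjoint ranges together
cover all nonzero residues. -/
theorem ne_zero_iff_exists_of_injective {n k : ℕ} (hn : n = 2 * k + 1) (f g : ℕ → ZMod n)
    (hf : ∀ i j, i < k → j < k → f i = f j → i = j)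
    (hg : ∀ i j, i < k → j < k → g i = g j → i = j)
    (hfg : ∀ i j, i < k → j < k → f i ≠ g j)
    (hf0 : ∀ i, i < k → f i ≠ 0) (hg0 : ∀ i, i < k → g i ≠ 0) (z : ZMod n) :
    z ≠ 0 ↔ ∃ i, i < k ∧ (f i = z ∨ g i = z) := by
  have : NeZero n := ⟨by omega⟩
  classical
  constructor
  · intro hz
    have hcf : ((Finset.range k).image f).card = k := by
      rw [Finset.card_image_of_injOn, Finset.card_range]
      intro i hi j hj h
      exact hf i j (by simpa using hi) (by simpa using hj) h
    have hcg : ((Finset.range k).image g).card = k := by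
      rw [Finset.card_image_of_injOn, Finset.card_range]
      intro i hi j hj h
      exact hg i j (by simpa using hi) (by simpa using hj) h
    have hdisj : Disjoint ((Finset.range k).image f) ((Finset.range k).image g) := by
      rw [Finset.disjoint_left]
      simp only [Finset.mem_image, Finset.mem_range]
      rintro _ ⟨i, hi, rfl⟩ ⟨j, hj, h⟩
      exact hfg i j hi hj h.symm
    have hsub : (Finset.range k).image f ∪ (Finset.range k).image g ⊆
        Finset.univ.erase (0 : ZMod n) := by
      intro w hw
      simp only [Finset.mem_union, Finset.mem_image, Finset.mem_range] at hw
      rcases hw with ⟨i, hi, rfl⟩ | ⟨i, hi, rfl⟩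
      · simpa using hf0 i hi
      · simpa using hg0 i hi
    have heq := Finset.eq_of_subset_of_card_le hsub (by
      rw [Finset.card_union_of_disjoint hdisj, hcf, hcg,
        Finset.card_erase_of_mem (Finset.mem_univ _), Finset.card_univ, ZMod.card]
      omega)
    have hmem : z ∈ (Finset.range k).image f ∪ (Finset.range k).image g := by
      rw [heq]; simpa using hz
    simp only [Finset.mem_union, Finset.mem_image, Finset.mem_range] at hmem
    rcases hmem with ⟨i, hi, h⟩ | ⟨i, hi, h⟩
    · exact ⟨i, hi, Or.inl h⟩
    · exact ⟨i, hi, Or.inr h⟩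
  · rintro ⟨i, hi, rfl | rfl⟩
    · exact hf0 i hi
    · exact hg0 i hi

theorem ZMod.natCast_inj_of_lt {n a b : ℕ} (ha : a < n) (hb : b < n)
    (h : (a : ZMod n) = b) : a = b := by
  rw [ZMod.natCast_eq_natCast_iff'] at h
  rwa [Nat.mod_eq_of_lt ha, Nat.mod_eq_of_lt hb] at h

theorem ZMod.eq_zero_of_add_self_eq_zero {k : ℕ} {a : ZMod (2 * k + 1)} (h : a + a = 0) :
    a = 0 := by
  have hcast : ((2 * k + 1 : ℕ) : ZMod (2 * k + 1)) = 0 := ZMod.natCast_self _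
  push_cast at hcast
  linear_combination a * hcast - (k : ZMod (2 * k + 1)) * h

theorem ZMod.eq_of_natCast_eq_or_eq_neg {q d e : ℕ} (hd : d ≤ q) (he : e ≤ q)
    (h : (d : ZMod (2 * q + 1)) = e ∨ (d : ZMod (2 * q + 1)) = -e) : d = e := by
  rcases h with h | h
  · exact ZMod.natCast_inj_of_lt (by omega) (by omega) h
  · have h0 : ((d + e : ℕ) : ZMod (2 * q + 1)) = (0 : ℕ) := by
      push_cast
      rw [h, neg_add_cancel]
    have := ZMod.natCast_inj_of_lt (by omega) (by omega) h0
    omega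

/-- The index `i` of a triplication table lies in row `(i+2)/3`, whose common difference is, up
to sign, the row number; this includes the index `0` as row `0`. -/
theorem IsTriplicationTable.exists_sign {q : ℕ} {u v : ℕ → ZMod (2 * q + 1)}
    (h : IsTriplicationTable q u v) :
    ∃ ε : ℕ → ℤ, (∀ d, ε d = 1 ∨ ε d = -1) ∧ ∀ i, i < 3 * q + 1 →
      v i - u i = (ε ((i + 2) / 3) : ZMod (2 * q + 1)) * (((i + 2) / 3 : ℕ) : ZMod (2 * q + 1)) := by
  obtain ⟨-, ⟨h0, -⟩, hd, -⟩ := h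
  have hex : ∀ d, ∃ ε : ℤ, (ε = 1 ∨ ε = -1) ∧ ∀ i, i < 3 * q + 1 → (i + 2) / 3 = d →
      v i - u i = (ε : ZMod (2 * q + 1)) * (d : ZMod (2 * q + 1)) := by
    intro d
    by_cases hdq : 1 ≤ d ∧ d ≤ q
    · obtain ⟨ε, hε, h1, h2, h3⟩ := hd d hdq.1 hdq.2
      refine ⟨ε, hε, fun i _ hid => ?_⟩
      have hi : i = 3 * d - 2 ∨ i = 3 * d - 1 ∨ i = 3 * d := by omega
      rcases hi with rfl | rfl | rfl <;> assumption
    · refine ⟨1, Or.inl rfl, fun i hi hid => ?_⟩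
      obtain rfl : i = 0 := by omega
      obtain rfl : d = 0 := by omega
      simp [h0]
  choose ε hε hrow using hex
  exact ⟨ε, hε, fun i hi => hrow _ i hi rfl⟩

/-- Two indices with equal differences lie in the same row. -/
theorem IsTriplicationTable.row_eq_of_sub_eq {q : ℕ} {u v : ℕ → ZMod (2 * q + 1)}
    (h : IsTriplicationTable q u v) {i j : ℕ} (hi : i < 3 * q + 1) (hj : j < 3 * q + 1)
    (hij : v i - u i = v j - u j) : (i + 2) / 3 = (j + 2) / 3 := by
  obtain ⟨ε, hε, hrow⟩ := h.exists_sign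
  rw [hrow i hi, hrow j hj] at hij
  refine ZMod.eq_of_natCast_eq_or_eq_neg (q := q) (by omega) (by omega) ?_
  rcases hε ((i + 2) / 3) with h1 | h1 <;> rcases hε ((j + 2) / 3) with h2 | h2 <;>
    rw [h1, h2] at hij <;> push_cast at hij
  · exact Or.inl (by linear_combination hij)
  · exact Or.inr (by linear_combination hij)
  · exact Or.inr (by linear_combination -hij)
  · exact Or.inl (by linear_combination -hij)

/-- Only the index `0` has a difference that is the negative of another one. -/
theorem IsTriplicationTable.eq_zero_of_sub_eq_neg {q : ℕ} {u v : ℕ → ZMod (2 * q + 1)}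
    (h : IsTriplicationTable q u v) {i j : ℕ} (hi : i < 3 * q + 1) (hj : j < 3 * q + 1)
    (hij : v i - u i = -(v j - u j)) : i = 0 ∧ j = 0 := by
  obtain ⟨ε, hε, hrow⟩ := h.exists_sign
  rw [hrow i hi, hrow j hj] at hij
  have hrows : (i + 2) / 3 = (j + 2) / 3 := by
    refine ZMod.eq_of_natCast_eq_or_eq_neg (q := q) (by omega) (by omega) ?_
    rcases hε ((i + 2) / 3) with h1 | h1 <;> rcases hε ((j + 2) / 3) with h2 | h2 <;>
      rw [h1, h2] at hij <;> push_cast at hij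
    · exact Or.inr (by linear_combination hij)
    · exact Or.inl (by linear_combination hij)
    · exact Or.inl (by linear_combination -hij)
    · exact Or.inr (by linear_combination -hij)
  rw [← hrows] at hij
  have hzero : (((i + 2) / 3 : ℕ) : ZMod (2 * q + 1)) = (0 : ℕ) := by
    rw [Nat.cast_zero]
    apply ZMod.eq_zero_of_add_self_eq_zero
    rcases hε ((i + 2) / 3) with h1 | h1 <;> rw [h1] at hij <;> push_cast at hij
    · linear_combination hij
    · linear_combination -hij
  have := ZMod.natCast_inj_of_lt (by omega) (by omega) hzero
  omega

/-- Mod scenario, `m = 3^ν·p` with `ν ≥ 1`, `p` odd coprime to `3`: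
given a triplication table of order `m = 2q+1` with integer representatives
`u i, v i ∈ {0,…,m−1}`, and discriminators `U i, V i ∈ {0,…,3^{ν+1}−1}` compatible
with `u i, v i` modulo `3^ν` and satisfying the Row, Sum, and Color constraints
modulo `3^{ν+1}`, the integers `x i ∈ {0,…,3m−1}` with `x i ≡ u i (mod m)` and
`x i ≡ U i (mod 3^{ν+1})` (and likewise `y i`) form a strong starter in `ℤ/(3m)`. -/
theorem stmt10 (p ν q : ℕ) (hp : Odd p) (hp3 : Nat.Coprime p 3) (hν : 1 ≤ ν)
    (hm : 2*q+1 = 3^ν * p)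
    (u v U V x y : ℕ → ℕ)
    (huv : ∀ i, i < 3*q+1 → u i < 2*q+1 ∧ v i < 2*q+1)
    (htt : IsTriplicationTable q (fun i => (u i : ZMod (2*q+1)))
      (fun i => (v i : ZMod (2*q+1))))
    (hUV : ∀ i, i < 3*q+1 → U i < 3^(ν+1) ∧ V i < 3^(ν+1))
    (hcompat : ∀ i, i < 3*q+1 →
      U i ≡ u i [MOD 3^ν] ∧ V i ≡ v i [MOD 3^ν])
    (row0 : (U 0 : ZMod (3^(ν+1))) - (V 0 : ZMod (3^(ν+1))) ≠ 0)
    (row : ∀ d, 1 ≤ d → d ≤ q →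
      (U (3*d-2) : ZMod (3^(ν+1))) - V (3*d-2)
        ≠ (U (3*d-1) : ZMod (3^(ν+1))) - V (3*d-1) ∧
      (U (3*d-2) : ZMod (3^(ν+1))) - V (3*d-2)
        ≠ (U (3*d) : ZMod (3^(ν+1))) - V (3*d) ∧
      (U (3*d-1) : ZMod (3^(ν+1))) - V (3*d-1)
        ≠ (U (3*d) : ZMod (3^(ν+1))) - V (3*d))
    (sum1 : ∀ i j, i < 3*q+1 → j < 3*q+1 → i ≠ j →
      u i + v i ≡ u j + v j [MOD 2*q+1] →
      (U i : ZMod (3^(ν+1))) + V i ≠ (U j : ZMod (3^(ν+1))) + V j)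
    (sum0 : ∀ i, i < 3*q+1 → u i + v i ≡ 0 [MOD 2*q+1] →
      (U i : ZMod (3^(ν+1))) + V i ≠ 0)
    (color : ∀ i j, i < 3*q+1 → j < 3*q+1 → ∀ bi bj : Bool, (i, bi) ≠ (j, bj) →
      (if bi then v i else u i) = (if bj then v j else u j) →
      (if bi then V i else U i) ≠ (if bj then V j else U j))
    (color0 : ∀ i, i < 3*q+1 → ∀ b : Bool,
      (if b then v i else u i) = 0 → (if b then V i else U i) ≠ 0)
    (hx : ∀ i, i < 3*q+1 →
      x i < 3*(2*q+1) ∧ x i ≡ u i [MOD 2*q+1] ∧ x i ≡ U i [MOD 3^(ν+1)])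
    (hy : ∀ i, i < 3*q+1 →
      y i < 3*(2*q+1) ∧ y i ≡ v i [MOD 2*q+1] ∧ y i ≡ V i [MOD 3^(ν+1)]) :
    IsStrongStarterIdx (3*(2*q+1)) (3*q+1)
      (fun i => (x i : ZMod (3*(2*q+1)))) (fun i => (y i : ZMod (3*(2*q+1)))) := by
  have hdvd : 3 ^ (ν + 1) ∣ 3 * (2 * q + 1) := ⟨p, by rw [hm]; ring⟩
  let red := redMod q
  let redPow := ZMod.castHom hdvd (ZMod (3 ^ (ν + 1)))
  have red_x : ∀ i, i < 3 * q + 1 → red (x i) = u i := fun i hi => by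
    rw [map_natCast]; exact (ZMod.natCast_eq_natCast_iff _ _ _).2 (hx i hi).2.1
  have red_y : ∀ i, i < 3 * q + 1 → red (y i) = v i := fun i hi => by
    rw [map_natCast]; exact (ZMod.natCast_eq_natCast_iff _ _ _).2 (hy i hi).2.1
  have redPow_x : ∀ i, i < 3 * q + 1 → redPow (x i) = U i := fun i hi => by
    rw [map_natCast]; exact (ZMod.natCast_eq_natCast_iff _ _ _).2 (hx i hi).2.2
  have redPow_y : ∀ i, i < 3 * q + 1 → redPow (y i) = V i := fun i hi => by
    rw [map_natCast]; exact (ZMod.natCast_eq_natCast_iff _ _ _).2 (hy i hi).2.2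
  have hxx : ∀ i j, i < 3 * q + 1 → j < 3 * q + 1 →
      (x i : ZMod (3 * (2 * q + 1))) = x j → i = j := by
    intro i j hi hj h
    by_contra hne
    have h1 := congrArg red h
    have h2 := congrArg redPow h
    rw [red_x i hi, red_x j hj] at h1
    rw [redPow_x i hi, redPow_x j hj] at h2
    exact color i j hi hj false false (by simpa using hne)
      (ZMod.natCast_inj_of_lt (huv i hi).1 (huv j hj).1 h1)
      (ZMod.natCast_inj_of_lt (hUV i hi).1 (hUV j hj).1 h2)
  have hyy : ∀ i j, i < 3 * q + 1 → j < 3 * q + 1 →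
      (y i : ZMod (3 * (2 * q + 1))) = y j → i = j := by
    intro i j hi hj h
    by_contra hne
    have h1 := congrArg red h
    have h2 := congrArg redPow h
    rw [red_y i hi, red_y j hj] at h1
    rw [redPow_y i hi, redPow_y j hj] at h2
    exact color i j hi hj true true (by simpa using hne)
      (ZMod.natCast_inj_of_lt (huv i hi).2 (huv j hj).2 h1)
      (ZMod.natCast_inj_of_lt (hUV i hi).2 (hUV j hj).2 h2)
  have hxy : ∀ i j, i < 3 * q + 1 → j < 3 * q + 1 →
      (x i : ZMod (3 * (2 * q + 1))) ≠ y j := by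
    intro i j hi hj h
    have h1 := congrArg red h
    have h2 := congrArg redPow h
    rw [red_x i hi, red_y j hj] at h1
    rw [redPow_x i hi, redPow_y j hj] at h2
    exact color i j hi hj false true (by simp)
      (ZMod.natCast_inj_of_lt (huv i hi).1 (huv j hj).2 h1)
      (ZMod.natCast_inj_of_lt (hUV i hi).1 (hUV j hj).2 h2)
  have hx0 : ∀ i, i < 3 * q + 1 → (x i : ZMod (3 * (2 * q + 1))) ≠ 0 := by
    intro i hi h
    have h1 := congrArg red h
    have h2 := congrArg redPow h
    rw [red_x i hi, map_zero, ← Nat.cast_zero] at h1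
    rw [redPow_x i hi, map_zero, ← Nat.cast_zero] at h2
    exact color0 i hi false (ZMod.natCast_inj_of_lt (huv i hi).1 (by omega) h1)
      (ZMod.natCast_inj_of_lt (hUV i hi).1 (by positivity) h2)
  have hy0 : ∀ i, i < 3 * q + 1 → (y i : ZMod (3 * (2 * q + 1))) ≠ 0 := by
    intro i hi h
    have h1 := congrArg red h
    have h2 := congrArg redPow h
    rw [red_y i hi, map_zero, ← Nat.cast_zero] at h1
    rw [redPow_y i hi, map_zero, ← Nat.cast_zero] at h2
    exact color0 i hi true (ZMod.natCast_inj_of_lt (huv i hi).2 (by omega) h1)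
      (ZMod.natCast_inj_of_lt (hUV i hi).2 (by positivity) h2)
  have hdiff : ∀ i j, i < 3 * q + 1 → j < 3 * q + 1 →
      (x i : ZMod (3 * (2 * q + 1))) - y i = x j - y j → i = j := by
    intro i j hi hj h
    have h1 := congrArg red h
    have h2 := congrArg redPow h
    rw [map_sub, map_sub, red_x i hi, red_x j hj, red_y i hi, red_y j hj] at h1
    rw [map_sub, map_sub, redPow_x i hi, redPow_x j hj, redPow_y i hi, redPow_y j hj] at h2
    have hrow := htt.row_eq_of_sub_eq hi hj (by linear_combination -h1)
    by_contra hne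
    obtain ⟨r1, r2, r3⟩ := row ((i + 2) / 3) (by omega) (by omega)
    have hi' : i = 3 * ((i + 2) / 3) - 2 ∨ i = 3 * ((i + 2) / 3) - 1 ∨ i = 3 * ((i + 2) / 3) := by
      omega
    have hj' : j = 3 * ((i + 2) / 3) - 2 ∨ j = 3 * ((i + 2) / 3) - 1 ∨ j = 3 * ((i + 2) / 3) := by
      omega
    generalize (i + 2) / 3 = d at *
    rcases hi' with rfl | rfl | rfl <;> rcases hj' with rfl | rfl | rfl <;>
      first
      | exact hne rfl
      | exact r1 h2
      | exact r2 h2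
      | exact r3 h2
      | exact r1 h2.symm
      | exact r2 h2.symm
      | exact r3 h2.symm
  have hdiff_neg : ∀ i j, i < 3 * q + 1 → j < 3 * q + 1 →
      (x i : ZMod (3 * (2 * q + 1))) - y i ≠ y j - x j := by
    intro i j hi hj h
    have h1 := congrArg red h
    rw [map_sub, map_sub, red_x i hi, red_x j hj, red_y i hi, red_y j hj] at h1
    obtain ⟨rfl, rfl⟩ := htt.eq_zero_of_sub_eq_neg hi hj (by linear_combination -h1)
    have h2 := congrArg redPow h
    rw [map_sub, map_sub, redPow_x 0 hi, redPow_y 0 hi] at h2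
    have hodd : Odd (3 ^ (ν + 1)) := Odd.pow (by decide)
    obtain ⟨k, hk⟩ := hodd
    rw [hk] at row0 h2
    exact row0 (ZMod.eq_zero_of_add_self_eq_zero (by linear_combination h2))
  have hsum : ∀ i j, i < 3 * q + 1 → j < 3 * q + 1 →
      (x i : ZMod (3 * (2 * q + 1))) + y i = x j + y j → i = j := by
    intro i j hi hj h
    by_contra hne
    have h1 := congrArg red h
    have h2 := congrArg redPow h
    rw [map_add, map_add, red_x i hi, red_x j hj, red_y i hi, red_y j hj] at h1
    rw [map_add, map_add, redPow_x i hi, redPow_x j hj, redPow_y i hi, redPow_y j hj] at h2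
    exact sum1 i j hi hj hne
      ((ZMod.natCast_eq_natCast_iff _ _ _).1 (by push_cast; exact h1)) h2
  have hsum0 : ∀ i, i < 3 * q + 1 → (x i : ZMod (3 * (2 * q + 1))) + y i ≠ 0 := by
    intro i hi h
    have h1 := congrArg red h
    have h2 := congrArg redPow h
    rw [map_add, red_x i hi, red_y i hi, map_zero] at h1
    rw [map_add, redPow_x i hi, redPow_y i hi, map_zero] at h2
    exact sum0 i hi ((ZMod.natCast_eq_natCast_iff _ _ _).1 (by push_cast; exact h1)) h2
  have hn : 3 * (2 * q + 1) = 2 * (3 * q + 1) + 1 := by ring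
  refine ⟨fun i j hi hj => ⟨hxx i j hi hj, hyy i j hi hj, hxy i j hi hj⟩,
    ne_zero_iff_exists_of_injective hn _ _ hxx hyy hxy hx0 hy0,
    fun i j hi hj => ⟨hdiff i j hi hj, hdiff_neg i j hi hj⟩,
    ne_zero_iff_exists_of_injective hn (fun i => (x i : ZMod (3 * (2 * q + 1))) - y i)
      (fun i => (y i : ZMod (3 * (2 * q + 1))) - x i) hdiff
      (fun i j hi hj h => hdiff i j hi hj (by linear_combination -h)) hdiff_neg
      (fun i hi h => hdiff_neg i i hi hi (by linear_combination 2 * h))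
      (fun i hi h => hdiff_neg i i hi hi (by linear_combination -2 * h)),
    hsum, hsum0⟩
end

section
/- Let m = 2q+1 ≥ 3 be odd and let T = [(x_1,y_1),…,(x_q,y_q)] be an ordered starter in ℤ/m. Let Sums(T) = {x_i + y_i (mod m) : i = 1,…,q}. If 0 ∈ Sums(T), then the set K(T) of admissible keys is empty; otherwise K(T) = (ℤ/m ∖ {0}) ∖ Sums(T). -/
/-- An ordered starter of order `m = 2q+1`, presented as a family of pairs
`(x i, y i)`, `i = 1,…,q`: the `2q` components are pairwise distinct and comprise
`ℤ/m ∖ {0}`, and `y i − x i = ±i` in `ℤ/m` for each `i`. -/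
def IsOrderedStarter (q : ℕ) (x y : ℕ → ZMod (2*q+1)) : Prop :=
  (∀ i j, 1 ≤ i → i ≤ q → 1 ≤ j → j ≤ q →
    (x i = x j → i = j) ∧ (y i = y j → i = j) ∧ x i ≠ y j) ∧
  (∀ z : ZMod (2*q+1), z ≠ 0 ↔ ∃ i, 1 ≤ i ∧ i ≤ q ∧ (x i = z ∨ y i = z)) ∧
  (∀ i, 1 ≤ i → i ≤ q →
    (y i - x i = (i : ZMod (2*q+1)) ∨ y i - x i = -(i : ZMod (2*q+1))))

/-- The triplication template `Σ⁰(T,t)` built from the ordered starter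
`T = [(x i, y i)]` and the key `t`, as a family of `3q+1` ordered pairs:
index `0 ↦ (t,t)`, and for `i = 1,…,q`, index `3i−2 ↦ (x i, y i)`,
index `3i−1 ↦ (t + x i, t + y i)`, index `3i ↦ (t − y i, t − x i)`. -/
def tmpl (q : ℕ) (x y : ℕ → ZMod (2*q+1)) (t : ZMod (2*q+1)) (i : ℕ) :
    ZMod (2*q+1) × ZMod (2*q+1) :=
  if i = 0 then (t, t)
  else if (i - 1) % 3 = 0 then (x ((i+2)/3), y ((i+2)/3))
  else if (i - 1) % 3 = 1 then (t + x ((i+2)/3), t + y ((i+2)/3))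
  else (t - y ((i+2)/3), t - x ((i+2)/3))

/-- The key `t` is admissible for the ordered starter `T = [(x i, y i)]` if `t ≠ 0`
and no two of the `3q+1` ordered pairs of the template `Σ⁰(T,t)` are equal. -/
def IsAdmissibleKey (q : ℕ) (x y : ℕ → ZMod (2*q+1)) (t : ZMod (2*q+1)) : Prop :=
  t ≠ 0 ∧ ∀ i j, i < 3*q+1 → j < 3*q+1 → tmpl q x y t i = tmpl q x y t j → i = j

theorem IsOrderedStarter.sub_ne_zero {q : ℕ} {x y : ℕ → ZMod (2*q+1)}
    (hT : IsOrderedStarter q x y) {i : ℕ} (hi : 1 ≤ i) (hi' : i ≤ q) : y i - x i ≠ 0 :=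
  fun h => (hT.1 i i hi hi' hi hi').2.2 (sub_eq_zero.mp h).symm

/-- The differences `y i - x i` of an ordered starter are pairwise distinct. -/
theorem IsOrderedStarter.sub_injOn {q : ℕ} {x y : ℕ → ZMod (2*q+1)}
    (hT : IsOrderedStarter q x y) {i j : ℕ} (hi : 1 ≤ i) (hi' : i ≤ q) (hj : 1 ≤ j)
    (hj' : j ≤ q) (h : y i - x i = y j - x j) : i = j := by
  have eq_of_cast (h : (i : ZMod (2*q+1)) = j) : i = j := by
    rw [ZMod.natCast_eq_natCast_iff'] at h
    rwa [Nat.mod_eq_of_lt (by omega), Nat.mod_eq_of_lt (by omega)] at h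
  have add_ne : (i : ZMod (2*q+1)) + j ≠ 0 := by
    rw [← Nat.cast_add, Ne, ZMod.natCast_eq_zero_iff]
    exact fun hd => by have := Nat.le_of_dvd (by omega) hd; omega
  rcases hT.2.2 i hi hi' with h₁ | h₁ <;> rcases hT.2.2 j hj hj' with h₂ | h₂ <;>
    rw [h₁, h₂] at h
  · exact eq_of_cast h
  · exact absurd (by rw [h]; ring) add_ne
  · exact absurd (by rw [← h]; ring) add_ne
  · exact eq_of_cast (neg_injective h)

theorem tmpl_three_mul_add_one (q : ℕ) (x y : ℕ → ZMod (2*q+1)) (t : ZMod (2*q+1)) (k : ℕ) :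
    tmpl q x y t (3*k+1) = (x (k+1), y (k+1)) := by
  have h : (3*k+1+2)/3 = k+1 := by omega
  rw [tmpl, if_neg (by omega), if_pos (by omega), h]

theorem tmpl_three_mul_add_two (q : ℕ) (x y : ℕ → ZMod (2*q+1)) (t : ZMod (2*q+1)) (k : ℕ) :
    tmpl q x y t (3*k+2) = (t + x (k+1), t + y (k+1)) := by
  have h : (3*k+2+2)/3 = k+1 := by omega
  rw [tmpl, if_neg (by omega), if_neg (by omega), if_pos (by omega), h]

theorem tmpl_three_mul_add_three (q : ℕ) (x y : ℕ → ZMod (2*q+1)) (t : ZMod (2*q+1)) (k : ℕ) :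
    tmpl q x y t (3*k+3) = (t - y (k+1), t - x (k+1)) := by
  have h : (3*k+3+2)/3 = k+1 := by omega
  rw [tmpl, if_neg (by omega), if_neg (by omega), if_neg (by omega), h]

theorem tmpl_snd_sub_fst (q : ℕ) (x y : ℕ → ZMod (2*q+1)) (t : ZMod (2*q+1)) {i : ℕ}
    (hi : i ≠ 0) :
    (tmpl q x y t i).2 - (tmpl q x y t i).1 = y ((i+2)/3) - x ((i+2)/3) := by
  unfold tmpl
  rw [if_neg hi]
  split_ifs <;> simp

theorem IsAdmissibleKey.add_ne_zero {q : ℕ} {x y : ℕ → ZMod (2*q+1)} {t : ZMod (2*q+1)}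
    (ht : IsAdmissibleKey q x y t) {i : ℕ} (hi : 1 ≤ i) (hi' : i ≤ q) : x i + y i ≠ 0 := by
  obtain ⟨k, rfl⟩ := Nat.exists_eq_add_of_le' hi
  intro h
  have := ht.2 (3*k+2) (3*k+3) (by omega) (by omega) (by
    rw [tmpl_three_mul_add_two, tmpl_three_mul_add_three, Prod.mk.injEq]
    exact ⟨by linear_combination h, by linear_combination h⟩)
  omega

theorem IsAdmissibleKey.add_ne_key {q : ℕ} {x y : ℕ → ZMod (2*q+1)} {t : ZMod (2*q+1)}
    (ht : IsAdmissibleKey q x y t) {i : ℕ} (hi : 1 ≤ i) (hi' : i ≤ q) : x i + y i ≠ t := by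
  obtain ⟨k, rfl⟩ := Nat.exists_eq_add_of_le' hi
  intro h
  have := ht.2 (3*k+1) (3*k+3) (by omega) (by omega) (by
    rw [tmpl_three_mul_add_one, tmpl_three_mul_add_three, Prod.mk.injEq]
    exact ⟨by linear_combination h, by linear_combination h⟩)
  omega

theorem IsOrderedStarter.isAdmissibleKey {q : ℕ} {x y : ℕ → ZMod (2*q+1)}
    (hT : IsOrderedStarter q x y) {t : ZMod (2*q+1)} (ht : t ≠ 0)
    (h_zero : ∀ i, 1 ≤ i → i ≤ q → x i + y i ≠ 0)
    (h_key : ∀ i, 1 ≤ i → i ≤ q → x i + y i ≠ t) : IsAdmissibleKey q x y t := by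
  have tmpl_ne {i : ℕ} (hi : i < 3*q+1) (hi₀ : i ≠ 0) : tmpl q x y t i ≠ tmpl q x y t 0 := by
    intro h
    refine hT.sub_ne_zero (i := (i+2)/3) (by omega) (by omega) ?_
    rw [← tmpl_snd_sub_fst q x y t hi₀, h]
    simp [tmpl]
  refine ⟨ht, fun i j hi hj h => ?_⟩
  rcases eq_or_ne i 0 with rfl | hi₀
  · by_contra hij
    exact tmpl_ne hj (Ne.symm hij) h.symm
  rcases eq_or_ne j 0 with rfl | hj₀
  · exact absurd h (tmpl_ne hi hi₀)
  have hk : (i+2)/3 = (j+2)/3 := by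
    refine hT.sub_injOn (by omega) (by omega) (by omega) (by omega) ?_
    rw [← tmpl_snd_sub_fst q x y t hi₀, ← tmpl_snd_sub_fst q x y t hj₀, h]
  obtain ⟨k, hkq, hik, hjk⟩ : ∃ k, k + 1 ≤ q ∧ (i = 3*k+1 ∨ i = 3*k+2 ∨ i = 3*k+3) ∧
      (j = 3*k+1 ∨ j = 3*k+2 ∨ j = 3*k+3) :=
    ⟨(i-1)/3, by omega, by omega, by omega⟩
  have hz := h_zero (k+1) (by omega) hkq
  have hs := h_key (k+1) (by omega) hkq
  rcases hik with rfl | rfl | rfl <;> rcases hjk with rfl | rfl | rfl <;>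
    simp only [tmpl_three_mul_add_one, tmpl_three_mul_add_two, tmpl_three_mul_add_three,
      Prod.mk.injEq] at h
  · rfl
  · exact absurd (by linear_combination -h.1) ht
  · exact absurd (by linear_combination h.1) hs
  · exact absurd (by linear_combination h.1) ht
  · rfl
  · exact absurd (by linear_combination h.1) hz
  · exact absurd (by linear_combination -h.1) hs
  · exact absurd (by linear_combination -h.1) hz
  · rfl

/-- Proposition `prop:num-good-keys`: for an ordered starter `T` of
order `m = 2q+1`, if `0` is a pair sum of `T` then there are no admissible keys;
otherwise the admissible keys are exactly the nonzero elements of `ℤ/m` that are not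
pair sums of `T`. -/
theorem stmt12 (q : ℕ) (hq : 1 ≤ q) (x y : ℕ → ZMod (2*q+1))
    (hT : IsOrderedStarter q x y) :
    ((∃ i, 1 ≤ i ∧ i ≤ q ∧ x i + y i = 0) → ∀ t, ¬ IsAdmissibleKey q x y t) ∧
    ((¬ ∃ i, 1 ≤ i ∧ i ≤ q ∧ x i + y i = 0) →
      ∀ t : ZMod (2*q+1), IsAdmissibleKey q x y t ↔
        (t ≠ 0 ∧ ¬ ∃ i, 1 ≤ i ∧ i ≤ q ∧ x i + y i = t)) := by
  refine ⟨fun ⟨i, hi, hi', h⟩ t ht => ht.add_ne_zero hi hi' h, fun h_zero t => ⟨?_, ?_⟩⟩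
  · exact fun ht => ⟨ht.1, fun ⟨i, hi, hi', h⟩ => ht.add_ne_key hi hi' h⟩
  · rintro ⟨ht, h_key⟩
    exact hT.isAdmissibleKey ht (fun i hi hi' h => h_zero ⟨i, hi, hi', h⟩)
      fun i hi hi' h => h_key ⟨i, hi, hi', h⟩
end

section
/- Let m = 2q+1 ≥ 3 be odd and let μ be an integer with 2 ≤ μ ≤ m−2 such that μ−1, μ, and μ+1 are all coprime with m. For i = 1,…,q let x_i ∈ ℤ/m be the unique solution of (μ−1)·x_i = i, and set E(μ) = [(x_1, μ·x_1),…,(x_q, μ·x_q)] and E′(μ) = [(−μ·x_1, −x_1),…,(−μ·x_q, −x_q)]. Then E(μ) and E′(μ) are disjoint: no ordered pair (x_i, μ·x_i) of E(μ) equals any ordered pair (−μ·x_j, −x_j) of E′(μ). -/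
/-- Proposition `prop:epi-pair` (b): if `μ−1`, `μ`, and `μ+1` are all
coprime with `m = 2q+1` and `x i` solves `(μ−1)·x i = i`, then the epicycloidal
pseudostarter `E(μ) = [(x i, μ·x i)]` and its conjugate `E′(μ) = [(−μ·x i, −x i)]`
are disjoint: no ordered pair of `E(μ)` equals an ordered pair of `E′(μ)`. -/
theorem stmt16 (q μ : ℕ) (hq : 1 ≤ q) (hμ2 : 2 ≤ μ) (hμm : μ ≤ 2*q-1)
    (hcop1 : Nat.Coprime (μ - 1) (2*q+1)) (hcop : Nat.Coprime μ (2*q+1))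
    (hcop2 : Nat.Coprime (μ + 1) (2*q+1))
    (x : ℕ → ZMod (2*q+1))
    (hx : ∀ i, 1 ≤ i → i ≤ q →
      ((μ : ZMod (2*q+1)) - 1) * x i = (i : ZMod (2*q+1))) :
    ∀ i j, 1 ≤ i → i ≤ q → 1 ≤ j → j ≤ q →
      (x i, (μ : ZMod (2*q+1)) * x i)
        ≠ (-((μ : ZMod (2*q+1)) * x j), -(x j)) := by
  intro i j hi hiq hj hjq h
  obtain ⟨h₁, h₂⟩ := Prod.mk.inj h
  have hzero : (((μ + 1) * (i + j) : ℕ) : ZMod (2*q+1)) = 0 := by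
    push_cast
    rw [← hx i hi hiq, ← hx j hj hjq]
    linear_combination ((μ : ZMod (2*q+1)) - 1) * (h₁ + h₂)
  have hdvd : 2*q+1 ∣ i + j :=
    hcop2.symm.dvd_of_dvd_mul_left ((ZMod.natCast_eq_zero_iff _ _).mp hzero)
  have hle := Nat.le_of_dvd (by omega) hdvd
  omega
end

section
/- Let m = 2q+1 ≥ 3 be odd with 3 ∣ m, and let μ be an integer with 2 ≤ μ ≤ m−2 such that μ−1 and μ are coprime with m. Then gcd(μ+1, m) > 1, and consequently the epicycloidal pseudostarters E(μ) and E′(μ) are not disjoint: there is an index i with (x_i, μ·x_i) = (−μ·x_i, −x_i), i.e. (μ+1)·x_i = 0 in ℤ/m. In particular, if 3 divides m there is no special pair of disjoint epicycloidal pseudostarters of order m. -/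
/-- Corollary `cor:case3` (b): if `3 ∣ m = 2q+1` and `μ−1`, `μ` are
coprime with `m` (with `x i` solving `(μ−1)·x i = i`), then `gcd(μ+1, m) > 1` and
the epicycloidal pseudostarters `E(μ)` and `E′(μ)` are not disjoint: some index `i`
has `(x i, μ·x i) = (−μ·x i, −x i)`, i.e. `(μ+1)·x i = 0` in `ℤ/m`. -/
theorem stmt18 (q μ : ℕ) (hq : 1 ≤ q) (h3 : 3 ∣ 2*q+1)
    (hμ2 : 2 ≤ μ) (hμm : μ ≤ 2*q-1)
    (hcop1 : Nat.Coprime (μ - 1) (2*q+1)) (hcop : Nat.Coprime μ (2*q+1))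
    (x : ℕ → ZMod (2*q+1))
    (hx : ∀ i, 1 ≤ i → i ≤ q →
      ((μ : ZMod (2*q+1)) - 1) * x i = (i : ZMod (2*q+1))) :
    1 < Nat.gcd (μ + 1) (2*q+1) ∧
    ∃ i, 1 ≤ i ∧ i ≤ q ∧
      ((μ : ZMod (2*q+1)) + 1) * x i = 0 ∧
      (x i, (μ : ZMod (2*q+1)) * x i) = (-((μ : ZMod (2*q+1)) * x i), -(x i)) := by
  have not_dvd_of_coprime : ∀ a : ℕ, Nat.Coprime a (2*q+1) → ¬ 3 ∣ a := fun a ha h =>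
    absurd (Nat.dvd_gcd h h3) (by rw [Nat.Coprime] at ha; omega)
  have h3μ : 3 ∣ μ + 1 := by
    have h₀ := not_dvd_of_coprime _ hcop
    have h₁ := not_dvd_of_coprime _ hcop1
    omega
  refine ⟨?_, ?_⟩
  · have := Nat.le_of_dvd (Nat.gcd_pos_of_pos_left _ (by omega)) (Nat.dvd_gcd h3μ h3)
    omega
  obtain ⟨k, hk⟩ := h3
  obtain ⟨t, ht⟩ := h3μ
  have hunit : IsUnit ((μ : ZMod (2*q+1)) - 1) := by
    have h := (ZMod.isUnit_iff_coprime (μ - 1) (2*q+1)).2 hcop1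
    rwa [Nat.cast_sub (by omega), Nat.cast_one] at h
  have hμk : ((μ : ZMod (2*q+1)) + 1) * k = 0 := by
    have h : (((μ + 1) * k : ℕ) : ZMod (2*q+1)) = 0 :=
      (ZMod.natCast_eq_zero_iff _ _).2 ⟨t, by rw [ht, hk]; ring⟩
    exact_mod_cast h
  have hzero : ((μ : ZMod (2*q+1)) + 1) * x k = 0 := by
    rw [← hunit.mul_right_eq_zero, mul_left_comm, hx k (by omega) (by omega), hμk]
  refine ⟨k, by omega, by omega, hzero, Prod.ext ?_ ?_⟩
  · linear_combination hzero
  · linear_combination hzero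
end
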